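/- arXiv:2506.18494 — 6 statements merged into one kernel-verified Lean document; each statement's English description precedes it below -/
import Mathlib

section
/- For any subset A of the binary cube E_2^n with |A| > 1 and |A| even, the rank satisfies 4·D_A ≤ R(A)·|A|², i.e. R(A) ≥ 4D_A/|A|². -/
/-- The rank of a subset `A` of the cube `E_q^n`: the number of coordinates at which
`A` is not constant (the dimension of the smallest face containing `A`). -/
def cubeRank {n q : ℕ} (A : Finset (Fin n → Fin q)) : ℕ :=
  (Finset.univ.filter fun i : Fin n => ∃ x ∈ A, ∃ y ∈ A, x i ≠ y i).card

/-- `D_A`: the sum of Hamming distances over all unordered pairs of distinct elements of `A`. -/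
def distSum {n q : ℕ} (A : Finset (Fin n → Fin q)) : ℕ :=
  (∑ x ∈ A, ∑ y ∈ A, hammingDist x y) / 2

/-- A two-valued function separates at most half of the ordered pairs of a finite set. -/
theorem two_mul_sum_ne_le_card_sq {α : Type*} (A : Finset α) (f : α → Fin 2) :
    2 * ∑ x ∈ A, ∑ y ∈ A, (if f x ≠ f y then 1 else 0) ≤ A.card ^ 2 := by
  have hcard := A.card_filter_add_card_filter_not (fun x => f x = 0)
  have hinner (x : α) : ∑ y ∈ A, (if f x ≠ f y then 1 else 0) =
      if f x = 0 then (A.filter fun y => ¬ f y = 0).card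
      else (A.filter fun y => f y = 0).card := by
    rw [← Finset.card_filter]
    split_ifs <;> congr 1 <;> apply Finset.filter_congr <;> intro y _ <;> omega
  simp only [hinner, Finset.sum_ite, Finset.sum_const, smul_eq_mul]
  rw [← hcard]
  nlinarith [four_mul_le_sq_add (A.filter fun y => f y = 0).card
    (A.filter fun y => ¬ f y = 0).card]

/-- The sum of Hamming distances over ordered pairs, computed coordinatewise. -/
theorem sum_hammingDist_eq_sum_coord {n q : ℕ} (A : Finset (Fin n → Fin q)) :
    ∑ x ∈ A, ∑ y ∈ A, hammingDist x y =
      ∑ i, ∑ x ∈ A, ∑ y ∈ A, (if x i ≠ y i then 1 else 0) := by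
  simp only [hammingDist, Finset.card_filter]
  simp_rw [Finset.sum_comm (s := A) (t := Finset.univ)]

theorem rank_lower_bound_even {n : ℕ} (A : Finset (Fin n → Fin 2))
    (h1 : 1 < A.card) (h2 : Even A.card) :
    4 * distSum A ≤ cubeRank A * A.card ^ 2 := by
  have hsum : 2 * ∑ x ∈ A, ∑ y ∈ A, hammingDist x y ≤ cubeRank A * A.card ^ 2 := by
    rw [sum_hammingDist_eq_sum_coord, Finset.mul_sum, cubeRank, Finset.card_filter,
      Finset.sum_mul]
    refine Finset.sum_le_sum fun i _ => ?_
    split_ifs with h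
    · simpa using two_mul_sum_ne_le_card_sq A fun x => x i
    · push Not at h
      simpa using h
  unfold distSum
  omega
end

section
/- For any subset A of the binary cube E_2^n with |A| > 1, the rank satisfies R(A)·(|A| − 1) ≤ D_A, i.e. R(A) ≤ D_A/(|A| − 1). -/
/-- A function that is not constant on `A` separates at least `2 * (#A - 1)` ordered pairs. -/
theorem two_mul_card_sub_one_le_sum_ne {α β : Type*} [DecidableEq β] (A : Finset α) (f : α → β)
    {a b : α} (ha : a ∈ A) (hb : b ∈ A) (hab : f a ≠ f b) :
    2 * (A.card - 1) ≤ ∑ x ∈ A, ∑ y ∈ A, if f x ≠ f y then 1 else 0 := by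
  set P := A.filter fun x => f x = f a with hP
  set Q := A.filter fun x => ¬ f x = f a with hQ
  have hcard : P.card + Q.card = A.card := Finset.card_filter_add_card_filter_not _
  have hPpos : 0 < P.card := Finset.card_pos.2 ⟨a, by simp [hP, ha]⟩
  have hQpos : 0 < Q.card := Finset.card_pos.2 ⟨b, by simp [hQ, hb, hab.symm]⟩
  have hrowP : ∀ x ∈ P, Q.card ≤ ∑ y ∈ A, if f x ≠ f y then 1 else 0 := by
    intro x hx
    rw [← Finset.card_filter]
    refine Finset.card_le_card fun y hy => ?_
    grind
  have hrowQ : ∀ x ∈ Q, P.card ≤ ∑ y ∈ A, if f x ≠ f y then 1 else 0 := by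
    intro x hx
    rw [← Finset.card_filter]
    refine Finset.card_le_card fun y hy => ?_
    grind
  have hsumP := Finset.card_nsmul_le_sum P _ _ hrowP
  have hsumQ := Finset.card_nsmul_le_sum Q _ _ hrowQ
  rw [smul_eq_mul] at hsumP hsumQ
  rw [← Finset.sum_filter_add_sum_filter_not A (fun x => f x = f a)]
  refine le_trans ?_ (add_le_add hsumP hsumQ)
  obtain ⟨p, hp⟩ := Nat.exists_eq_succ_of_ne_zero hPpos.ne'
  obtain ⟨q, hq⟩ := Nat.exists_eq_succ_of_ne_zero hQpos.ne'
  have hA : A.card - 1 = p + q + 1 := by omega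
  rw [hA, hp, hq]
  simp only [Nat.succ_eq_add_one]
  nlinarith [Nat.zero_le (p * q)]

theorem rank_upper_bound {n : ℕ} (A : Finset (Fin n → Fin 2)) (h1 : 1 < A.card) :
    cubeRank A * (A.card - 1) ≤ distSum A := by
  have hswap : ∑ x ∈ A, ∑ y ∈ A, hammingDist x y =
      ∑ i : Fin n, ∑ x ∈ A, ∑ y ∈ A, if x i ≠ y i then 1 else 0 := by
    simp only [hammingDist, Finset.card_filter]
    rw [Finset.sum_comm]
    simp_rw [Finset.sum_comm (s := A) (t := Finset.univ)]
    exact Finset.sum_congr rfl fun i _ => Finset.sum_comm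
  rw [distSum, Nat.le_div_iff_mul_le two_pos, hswap, mul_assoc, mul_comm _ 2, cubeRank,
    ← smul_eq_mul]
  refine (Finset.card_nsmul_le_sum _ _ _ fun i hi => ?_).trans
    (Finset.sum_le_sum_of_subset (Finset.filter_subset _ _))
  obtain ⟨a, ha, b, hb, hab⟩ := (Finset.mem_filter.1 hi).2
  exact two_mul_card_sub_one_le_sum_ne A (fun x => x i) ha hb hab
end

section
/- For any subset A of the binary cube E_2^n with |A| > 1 and |A| odd, the rank satisfies 4·D_A ≤ R(A)·(|A|² − 1), i.e. R(A) ≥ 4D_A/(|A|² − 1). -/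
theorem two_mul_sum_sum_ne_le {α : Type*} (A : Finset α) (f : α → Fin 2) (hA : Odd A.card) :
    2 * ∑ x ∈ A, ∑ y ∈ A, (if f x ≠ f y then 1 else 0) ≤ A.card ^ 2 - 1 := by
  set a := (A.filter fun x => f x = 0).card with ha
  set b := (A.filter fun x => ¬ f x = 0).card with hb
  have hab : a + b = A.card := A.card_filter_add_card_filter_not _
  have hinner (x : α) : ∑ y ∈ A, (if f x ≠ f y then 1 else 0) = if f x = 0 then b else a := by
    rw [← Finset.card_filter]
    split_ifs with hx
    · exact congrArg Finset.card (Finset.filter_congr fun y _ => by rw [hx]; exact ne_comm)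
    · exact congrArg Finset.card (Finset.filter_congr fun y _ => by omega)
  simp only [hinner, Finset.sum_ite, Finset.sum_const, smul_eq_mul, ← ha, ← hb]
  rw [← hab] at hA ⊢
  apply Nat.le_sub_of_add_le
  have hne : a ≠ b := by
    rintro h
    rw [h] at hA
    exact Nat.not_odd_iff_even.mpr (Even.add_self b) hA
  rcases lt_or_gt_of_ne hne with h | h
  · obtain ⟨k, hk⟩ := Nat.exists_eq_add_of_lt h
    rw [hk]
    nlinarith
  · obtain ⟨k, hk⟩ := Nat.exists_eq_add_of_lt h
    rw [hk]
    nlinarith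

theorem sum_sum_hammingDist {ι β : Type*} [Fintype ι] [DecidableEq β] (A : Finset (ι → β)) :
    ∑ x ∈ A, ∑ y ∈ A, hammingDist x y =
      ∑ i, ∑ x ∈ A, ∑ y ∈ A, if x i ≠ y i then 1 else 0 := by
  simp only [hammingDist, Finset.card_filter]
  rw [Finset.sum_comm]
  simp_rw [Finset.sum_comm (s := Finset.univ)]
  rw [Finset.sum_comm]

theorem rank_lower_bound_odd {n : ℕ} (A : Finset (Fin n → Fin 2))
    (h1 : 1 < A.card) (h2 : Odd A.card) :
    4 * distSum A ≤ cubeRank A * (A.card ^ 2 - 1) := by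
  calc 4 * distSum A ≤ 2 * ∑ x ∈ A, ∑ y ∈ A, hammingDist x y := by
        unfold distSum
        omega
    _ = ∑ i, 2 * ∑ x ∈ A, ∑ y ∈ A, (if x i ≠ y i then 1 else 0) := by
        rw [sum_sum_hammingDist, Finset.mul_sum]
    _ ≤ ∑ i, if ∃ x ∈ A, ∃ y ∈ A, x i ≠ y i then A.card ^ 2 - 1 else 0 := by
        refine Finset.sum_le_sum fun i _ => ?_
        split_ifs with h
        · exact two_mul_sum_sum_ne_le A (fun x => x i) h2
        · push Not at h
          rw [Finset.sum_eq_zero fun x hx => Finset.sum_eq_zero fun y hy =>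
            if_neg (not_not.mpr (h x hx y hy)), mul_zero]
    _ = cubeRank A * (A.card ^ 2 - 1) := by
        rw [← Finset.sum_filter, Finset.sum_const, smul_eq_mul, cubeRank]
end

section
/- Let A be a non-empty finite subset of E_q^n (q ≥ 2), and let k, s be integers with 0 ≤ k ≤ n and 1 ≤ s ≤ p(k), where p(k) = min{|A|, q^k}. Then Σ_{e=s}^{p(k)} C(e, s)·V(A, k, e) = Σ_{B ⊆ A, |B| = s} C(n − R(B), k − R(B)), where the right-hand sum ranges over all s-element subsets B of A and C(m, j) = 0 for j < 0. -/
/-- `F` is a `k`-dimensional face of `E_q^n`: all vectors agreeing with some fixed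
values `c` outside a set `S` of `k` free coordinates. -/
def IsFace {n q : ℕ} (k : ℕ) (F : Finset (Fin n → Fin q)) : Prop :=
  ∃ S : Finset (Fin n), S.card = k ∧ ∃ c : Fin n → Fin q,
    F = Finset.univ.filter fun x => ∀ i ∉ S, x i = c i

/-- Binomial coefficient `C(m, j)` with an integer lower argument, equal to `0` for `j < 0`. -/
def chooseZ (m : ℕ) (j : ℤ) : ℕ := if j < 0 then 0 else m.choose j.toNat

/-- The face with free coordinates `S` through the vector `c`. -/
def cubeFace {n q : ℕ} (S : Finset (Fin n)) (c : Fin n → Fin q) : Finset (Fin n → Fin q) :=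
  Finset.univ.filter fun x => ∀ i ∉ S, x i = c i

/-- The coordinates at which `B` is not constant. -/
def varyingCoords {n q : ℕ} (B : Finset (Fin n → Fin q)) : Finset (Fin n) :=
  Finset.univ.filter fun i => ∃ x ∈ B, ∃ y ∈ B, x i ≠ y i

theorem mem_cubeFace {n q : ℕ} {S : Finset (Fin n)} {c x : Fin n → Fin q} :
    x ∈ cubeFace S c ↔ ∀ i ∉ S, x i = c i := by
  simp [cubeFace]

theorem cubeFace_eq_of_mem {n q : ℕ} {S : Finset (Fin n)} {b c : Fin n → Fin q}
    (hb : b ∈ cubeFace S c) : cubeFace S c = cubeFace S b := by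
  rw [mem_cubeFace] at hb
  ext x
  simp only [mem_cubeFace]
  exact forall₂_congr fun i hi => by rw [hb i hi]

theorem card_cubeFace_le {n q : ℕ} (S : Finset (Fin n)) (c : Fin n → Fin q) :
    (cubeFace S c).card ≤ q ^ S.card := by
  have h : (cubeFace S c).card ≤ (Finset.univ : Finset (S → Fin q)).card := by
    refine Finset.card_le_card_of_injOn (fun x i => x i) (fun _ _ => Finset.mem_univ _) ?_
    intro x hx y hy hxy
    have hx' := mem_cubeFace.1 hx
    have hy' := mem_cubeFace.1 hy
    funext i
    by_cases hi : i ∈ S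
    · exact congrFun hxy ⟨i, hi⟩
    · rw [hx' i hi, hy' i hi]
  simpa using h

theorem subset_of_cubeFace_subset {n q : ℕ} (hq : 2 ≤ q) {S T : Finset (Fin n)}
    {b : Fin n → Fin q} (h : cubeFace S b ⊆ cubeFace T b) : S ⊆ T := by
  intro i hi
  by_contra hiT
  have : Nontrivial (Fin q) := Fin.nontrivial_iff_two_le.2 hq
  obtain ⟨a, ha⟩ := exists_ne (b i)
  have hmem : Function.update b i a ∈ cubeFace S b := by
    rw [mem_cubeFace]
    intro j hj
    exact Function.update_of_ne (by rintro rfl; exact hj hi) _ _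
  have hia := mem_cubeFace.1 (h hmem) i hiT
  rw [Function.update_self] at hia
  exact ha hia

theorem subset_cubeFace_iff {n q : ℕ} {B : Finset (Fin n → Fin q)} {b : Fin n → Fin q}
    (hb : b ∈ B) (S : Finset (Fin n)) : B ⊆ cubeFace S b ↔ varyingCoords B ⊆ S := by
  constructor
  · intro h i hi
    by_contra hiS
    obtain ⟨x, hx, y, hy, hxy⟩ := (Finset.mem_filter.1 hi).2
    exact hxy ((mem_cubeFace.1 (h hx) i hiS).trans (mem_cubeFace.1 (h hy) i hiS).symm)
  · intro h x hx
    rw [mem_cubeFace]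
    intro i hi
    by_contra hne
    exact hi (h (Finset.mem_filter.2 ⟨Finset.mem_univ _, x, hx, b, hb, hne⟩))

theorem card_filter_superset {α : Type*} [Fintype α] [DecidableEq α] (V : Finset α) (k : ℕ) :
    ((Finset.powersetCard k Finset.univ).filter fun S => V ⊆ S).card =
      chooseZ (Fintype.card α - V.card) ((k : ℤ) - V.card) := by
  unfold chooseZ
  split_ifs with hlt
  · rw [Finset.card_eq_zero, Finset.filter_eq_empty_iff]
    intro S hS hVS
    have := Finset.card_le_card hVS
    rw [(Finset.mem_powersetCard.1 hS).2] at this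
    omega
  · have hk : ((k : ℤ) - V.card).toNat = k - V.card := by omega
    rw [hk, ← Finset.card_compl, ← Finset.card_powersetCard]
    refine Finset.card_bij' (fun S _ => S \ V) (fun T _ => T ∪ V) ?_ ?_ ?_ ?_
    · intro S hS
      simp only [Finset.mem_filter, Finset.mem_powersetCard] at hS ⊢
      refine ⟨fun i hi => Finset.mem_compl.2 (Finset.mem_sdiff.1 hi).2, ?_⟩
      rw [Finset.card_sdiff_of_subset hS.2, hS.1.2]
    · intro T hT
      simp only [Finset.mem_filter, Finset.mem_powersetCard] at hT ⊢
      refine ⟨⟨Finset.subset_univ _, ?_⟩, Finset.subset_union_right⟩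
      rw [Finset.card_union_of_disjoint (Finset.subset_compl_iff_disjoint_right.1 hT.1), hT.2]
      omega
    · intro S hS
      exact Finset.sdiff_union_of_subset (Finset.mem_filter.1 hS).2
    · intro T hT
      have hd := Finset.subset_compl_iff_disjoint_right.1 (Finset.mem_powersetCard.1 hT).1
      exact Finset.union_sdiff_cancel_right hd

open Classical in
theorem card_faces_superset {n q : ℕ} (hq : 2 ≤ q) {B : Finset (Fin n → Fin q)}
    (hB : B.Nonempty) (k : ℕ) :
    (Finset.univ.filter fun F : Finset (Fin n → Fin q) => IsFace k F ∧ B ⊆ F).card =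
      chooseZ (n - cubeRank B) ((k : ℤ) - cubeRank B) := by
  obtain ⟨b, hb⟩ := hB
  have hrank : cubeRank B = (varyingCoords B).card := rfl
  have hcount := card_filter_superset (varyingCoords B) k
  rw [Fintype.card_fin] at hcount
  rw [hrank, ← hcount]
  symm
  refine Finset.card_bij (fun S _ => cubeFace S b) ?_ ?_ ?_
  · intro S hS
    simp only [Finset.mem_filter, Finset.mem_powersetCard] at hS
    exact Finset.mem_filter.2 ⟨Finset.mem_univ _, ⟨S, hS.1.2, b, rfl⟩,
      (subset_cubeFace_iff hb S).2 hS.2⟩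
  · intro S _ T _ h
    exact (subset_of_cubeFace_subset hq h.subset).antisymm
      (subset_of_cubeFace_subset hq h.superset)
  · intro F hF
    obtain ⟨-, ⟨S, hS, c, hc⟩, hBF⟩ := Finset.mem_filter.1 hF
    change F = cubeFace S c at hc
    subst hc
    have hSb := cubeFace_eq_of_mem (hBF hb)
    refine ⟨S, ?_, hSb.symm⟩
    rw [hSb, subset_cubeFace_iff hb] at hBF
    exact Finset.mem_filter.2
      ⟨Finset.mem_powersetCard.2 ⟨Finset.subset_univ _, hS⟩, hBF⟩

theorem IsFace.card_le {n q k : ℕ} {F : Finset (Fin n → Fin q)} (hF : IsFace k F) :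
    F.card ≤ q ^ k := by
  obtain ⟨S, rfl, c, rfl⟩ := hF
  exact card_cubeFace_le S c

theorem main_identity {n q : ℕ} (hq : 2 ≤ q)
    (A : Finset (Fin n → Fin q)) (hA : A.Nonempty) (k s : ℕ) (hk : k ≤ n)
    (hs1 : 1 ≤ s) (hs2 : s ≤ min A.card (q ^ k)) :
    ∑ e ∈ Finset.Icc s (min A.card (q ^ k)),
        e.choose s *
          {F : Finset (Fin n → Fin q) | IsFace k F ∧ (A ∩ F).card = e}.ncard =
      ∑ B ∈ A.powersetCard s, chooseZ (n - cubeRank B) ((k : ℤ) - cubeRank B) := by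
  classical
  set 𝓕 : Finset (Finset (Fin n → Fin q)) := Finset.univ.filter (IsFace k) with h𝓕
  have hncard (e : ℕ) :
      {F : Finset (Fin n → Fin q) | IsFace k F ∧ (A ∩ F).card = e}.ncard =
        (𝓕.filter fun F => (A ∩ F).card = e).card := by
    rw [← Set.ncard_coe_finset]
    congr 1
    ext F
    simp [h𝓕]
  calc
    _ = ∑ e ∈ Finset.Icc s (min A.card (q ^ k)),
          ∑ F ∈ 𝓕 with (A ∩ F).card = e, (A ∩ F).card.choose s := by
      refine Finset.sum_congr rfl fun e _ => ?_
      rw [hncard, mul_comm, ← smul_eq_mul, ← Finset.sum_const]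
      exact Finset.sum_congr rfl fun F hF => by rw [(Finset.mem_filter.1 hF).2]
    _ = ∑ F ∈ 𝓕, (A ∩ F).card.choose s := by
      rw [Finset.sum_fiberwise_eq_sum_filter, Finset.sum_filter_of_ne]
      intro F hF hne
      have hle := Nat.le_of_not_lt fun h => hne (Nat.choose_eq_zero_of_lt h)
      exact Finset.mem_Icc.2 ⟨hle, le_min (Finset.card_le_card Finset.inter_subset_left)
        ((Finset.card_le_card Finset.inter_subset_right).trans
          (IsFace.card_le (Finset.mem_filter.1 hF).2))⟩
    _ = ∑ F ∈ 𝓕, ((A.powersetCard s).filter fun B => B ⊆ F).card := by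
      refine Finset.sum_congr rfl fun F _ => ?_
      rw [← Finset.card_powersetCard]
      congr 1
      ext B
      simp only [Finset.mem_powersetCard, Finset.mem_filter, Finset.subset_inter_iff]
      tauto
    _ = ∑ B ∈ A.powersetCard s, (𝓕.filter fun F => B ⊆ F).card := by
      simp only [Finset.card_filter]
      exact Finset.sum_comm
    _ = _ := by
      refine Finset.sum_congr rfl fun B hB => ?_
      have hBne : B.Nonempty := Finset.card_pos.1 (by
        rw [(Finset.mem_powersetCard.1 hB).2]
        exact hs1)
      rw [← card_faces_superset hq hBne k, h𝓕, Finset.filter_filter]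
end

section
/- For integers q ≥ 2, n ≥ 0, 0 ≤ ν ≤ n and 0 ≤ k ≤ n, the following binomial identity holds: Σ_{i=1}^{ν} (q^i − 1)·C(ν, i)·C(n−ν, k−i) = Σ_{i=1}^{ν} (q−1)^i·C(ν, i)·C(n−i, k−i), with the convention C(m, j) = 0 for j < 0. -/
open Polynomial in
theorem coeff_C_mul_X_pow_mul_X_add_one_pow (a N i k : ℕ) :
    ((C a * X) ^ i * (X + 1 : ℕ[X]) ^ N).coeff k = a ^ i * chooseZ N ((k : ℤ) - i) := by
  rw [mul_pow, ← C_pow, mul_assoc, coeff_C_mul, coeff_X_pow_mul', coeff_X_add_one_pow, chooseZ]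
  by_cases h : i ≤ k
  · rw [if_pos h, if_neg (by omega), show ((k : ℤ) - i).toNat = k - i by omega, Nat.cast_id]
  · rw [if_neg h, if_pos (by omega)]

open Polynomial in
theorem sum_pow_mul_choose_mul_chooseZ (a m ν k : ℕ) :
    ∑ i ∈ Finset.range (ν + 1), a ^ i * ν.choose i * chooseZ m ((k : ℤ) - i) =
      ((C a * X + 1) ^ ν * (X + 1 : ℕ[X]) ^ m).coeff k := by
  rw [add_pow, Finset.sum_mul, finsetSum_coeff]
  refine Finset.sum_congr rfl fun i _ => ?_
  rw [one_pow, mul_one, mul_right_comm _ _ ((X + 1 : ℕ[X]) ^ m), coeff_mul_natCast,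
    coeff_C_mul_X_pow_mul_X_add_one_pow, Nat.cast_id, mul_right_comm]

open Polynomial in
theorem sum_pow_mul_choose_mul_chooseZ_sub (a n ν k : ℕ) (hν : ν ≤ n) :
    ∑ i ∈ Finset.range (ν + 1), a ^ i * ν.choose i * chooseZ (n - i) ((k : ℤ) - i) =
      ((C (a + 1) * X + 1) ^ ν * (X + 1 : ℕ[X]) ^ (n - ν)).coeff k := by
  have h : C (a + 1) * X + 1 = C a * X + (X + 1 : ℕ[X]) := by
    rw [C_add, C_1]; ring
  rw [h, add_pow, Finset.sum_mul, finsetSum_coeff]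
  refine Finset.sum_congr rfl fun i hi => ?_
  have hi' : n - i = (ν - i) + (n - ν) := by
    have := Finset.mem_range.mp hi
    omega
  rw [mul_right_comm _ _ ((X + 1 : ℕ[X]) ^ (n - ν)), coeff_mul_natCast, mul_assoc _ _ (_ ^ (n - ν)),
    ← pow_add, ← hi', coeff_C_mul_X_pow_mul_X_add_one_pow, Nat.cast_id, mul_right_comm]

theorem sum_range_succ_eq_add_sum_Icc (f : ℕ → ℕ) (ν : ℕ) :
    ∑ i ∈ Finset.range (ν + 1), f i = f 0 + ∑ i ∈ Finset.Icc 1 ν, f i := by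
  rw [Finset.range_eq_Ico, Finset.sum_eq_sum_Ico_succ_bot (Nat.succ_pos ν)]
  rfl

theorem vandermonde_variation (q n ν k : ℕ) (hq : 2 ≤ q) (hν : ν ≤ n) (hk : k ≤ n) :
    ∑ i ∈ Finset.Icc 1 ν, (q ^ i - 1) * ν.choose i * chooseZ (n - ν) ((k : ℤ) - i) =
      ∑ i ∈ Finset.Icc 1 ν, (q - 1) ^ i * ν.choose i * chooseZ (n - i) ((k : ℤ) - i) := by
  have hsplit : ∑ i ∈ Finset.range (ν + 1),
        (q ^ i - 1) * ν.choose i * chooseZ (n - ν) ((k : ℤ) - i) +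
      ∑ i ∈ Finset.range (ν + 1), 1 ^ i * ν.choose i * chooseZ (n - ν) ((k : ℤ) - i) =
      ∑ i ∈ Finset.range (ν + 1), q ^ i * ν.choose i * chooseZ (n - ν) ((k : ℤ) - i) := by
    rw [← Finset.sum_add_distrib]
    refine Finset.sum_congr rfl fun i _ => ?_
    rw [one_pow, ← add_mul, ← add_mul, Nat.sub_add_cancel (Nat.one_le_pow _ _ (by omega))]
  have hq' := sum_pow_mul_choose_mul_chooseZ_sub (q - 1) n ν k hν
  rw [Nat.sub_add_cancel (by omega : 1 ≤ q), ← sum_pow_mul_choose_mul_chooseZ] at hq'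
  have h0 := sum_pow_mul_choose_mul_chooseZ_sub 0 n ν k hν
  rw [zero_add, ← sum_pow_mul_choose_mul_chooseZ] at h0
  rw [← hq', ← h0, sum_range_succ_eq_add_sum_Icc, sum_range_succ_eq_add_sum_Icc,
    sum_range_succ_eq_add_sum_Icc] at hsplit
  have hz : ∑ i ∈ Finset.Icc 1 ν, 0 ^ i * ν.choose i * chooseZ (n - i) ((k : ℤ) - i) = 0 := by
    refine Finset.sum_eq_zero fun i hi => ?_
    rw [zero_pow (by have := Finset.mem_Icc.mp hi; omega), zero_mul, zero_mul]
  rw [hz] at hsplit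
  simp only [pow_zero, Nat.sub_self, zero_mul, zero_add, add_zero] at hsplit
  omega
end

section
/- Let A be a ν-dimensional face of E_q^n (q ≥ 2, 0 ≤ ν ≤ n) and let k be an integer with 0 ≤ k ≤ n. Then the number of k-dimensional faces of E_q^n containing no element of A equals Σ_{i=0}^{ν} q^{ν−i}·C(ν, i)·C(n−ν, k−i)·(q^{n−ν−k+i} − 1), with the convention C(m, j) = 0 for j < 0. -/
theorem card_cubeFace {n q : ℕ} (S : Finset (Fin n)) (c : Fin n → Fin q) :
    (cubeFace S c).card = q ^ S.card := by
  have h : cubeFace S c = Fintype.piFinset fun i => if i ∈ S then Finset.univ else {c i} := by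
    ext x
    simp only [mem_cubeFace, Fintype.mem_piFinset]
    refine forall_congr' fun i => ?_
    by_cases hi : i ∈ S <;> simp [hi]
  rw [h, Fintype.card_piFinset]
  simp [apply_ite Finset.card]

theorem subset_of_cubeFace_eq {n q : ℕ} (hq : 2 ≤ q) {S S' : Finset (Fin n)}
    {c c' : Fin n → Fin q} (h : cubeFace S c = cubeFace S' c') : S ⊆ S' := by
  intro i hi
  by_contra hi'
  have : Nontrivial (Fin q) := Fin.nontrivial_iff_two_le.mpr hq
  obtain ⟨v, hv⟩ := exists_ne (c' i)
  have hx : Function.update c i v ∈ cubeFace S c := by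
    rw [mem_cubeFace]
    intro j hj
    rw [Function.update_of_ne (by rintro rfl; exact hj hi)]
  rw [h, mem_cubeFace] at hx
  exact hv (by simpa using hx i hi')

theorem cubeFace_eq_iff {n q : ℕ} (hq : 2 ≤ q) {S S' : Finset (Fin n)}
    {c c' : Fin n → Fin q} :
    cubeFace S c = cubeFace S' c' ↔ S = S' ∧ ∀ i ∉ S, c i = c' i := by
  constructor
  · intro h
    have hS : S = S' :=
      (subset_of_cubeFace_eq hq h).antisymm (subset_of_cubeFace_eq hq h.symm)
    subst hS
    refine ⟨rfl, ?_⟩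
    rw [← mem_cubeFace, ← h, mem_cubeFace]
    exact fun _ _ => rfl
  · rintro ⟨rfl, h⟩
    ext x
    simp only [mem_cubeFace]
    exact forall₂_congr fun i hi => by rw [h i hi]

theorem cubeFace_inter_eq_empty_iff {n q : ℕ} {S T : Finset (Fin n)} {c a : Fin n → Fin q} :
    cubeFace T a ∩ cubeFace S c = ∅ ↔ c ∉ cubeFace (S ∪ T) a := by
  rw [← not_iff_not, not_not, ← Ne, ← Finset.nonempty_iff_ne_empty]
  constructor
  · rintro ⟨x, hx⟩
    simp only [Finset.mem_inter, mem_cubeFace] at hx ⊢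
    intro i hi
    rw [Finset.notMem_union] at hi
    rw [← hx.1 i hi.2, hx.2 i hi.1]
  · intro h
    rw [mem_cubeFace] at h
    refine ⟨fun i => if i ∈ S then a i else c i, ?_⟩
    simp only [Finset.mem_inter, mem_cubeFace]
    refine ⟨fun i hi => ?_, fun i hi => by simp [hi]⟩
    by_cases hS : i ∈ S
    · simp [hS]
    · simpa [hS] using h i (by simp [hS, hi])

theorem card_filter_card_inter_eq {α : Type*} [Fintype α] [DecidableEq α] (T : Finset α)
    (k i : ℕ) :
    ((Finset.univ.powersetCard k).filter fun S : Finset α => (S ∩ T).card = i).card =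
      T.card.choose i * chooseZ (Fintype.card α - T.card) ((k : ℤ) - i) := by
  by_cases hik : i ≤ k
  · have hz : chooseZ (Fintype.card α - T.card) ((k : ℤ) - i) = (Tᶜ.card).choose (k - i) := by
      rw [chooseZ, if_neg (by omega), Finset.card_compl]
      congr 1
      omega
    rw [hz, ← Finset.card_powersetCard i T, ← Finset.card_powersetCard (k - i) Tᶜ,
      ← Finset.card_product]
    refine Finset.card_nbij' (fun S => (S ∩ T, S \ T)) (fun P => P.1 ∪ P.2) ?_ ?_ ?_ ?_
    · intro S hS
      simp only [Finset.mem_coe, Finset.mem_filter, Finset.mem_powersetCard,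
        Finset.mem_product] at hS ⊢
      have := Finset.card_inter_add_card_sdiff S T
      refine ⟨⟨Finset.inter_subset_right, hS.2⟩, ?_, by omega⟩
      intro x hx
      simp at hx ⊢
      exact hx.2
    · rintro ⟨P, Q⟩ h
      simp only [Finset.mem_coe, Finset.mem_filter, Finset.mem_powersetCard,
        Finset.mem_product] at h ⊢
      obtain ⟨⟨hP, hPi⟩, hQ, hQi⟩ := h
      have hd : Disjoint Q T := Finset.subset_compl_iff_disjoint_right.mp hQ
      have hd' : Disjoint P Q := (hd.mono_right hP).symm
      refine ⟨⟨Finset.subset_univ _, ?_⟩, ?_⟩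
      · rw [Finset.card_union_of_disjoint hd']
        omega
      · rw [Finset.union_inter_distrib_right, Finset.inter_eq_left.mpr hP,
          Finset.disjoint_iff_inter_eq_empty.mp hd, Finset.union_empty, hPi]
    · intro S _
      ext x
      simp
      tauto
    · rintro ⟨P, Q⟩ h
      simp only [Finset.mem_coe, Finset.mem_powersetCard, Finset.mem_product] at h
      obtain ⟨⟨hP, -⟩, hQ, -⟩ := h
      have hQ' : ∀ x ∈ Q, x ∉ T := fun x hx => Finset.mem_compl.mp (hQ hx)
      simp only [Prod.mk.injEq]
      constructor <;> ext x <;> have h1 := @hP x <;> have h2 := hQ' x <;> simp <;> tauto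
  · rw [chooseZ, if_pos (by omega), mul_zero, Finset.card_eq_zero, Finset.filter_eq_empty_iff]
    intro S hS hi
    have := Finset.card_le_card (Finset.inter_subset_left (s₁ := S) (s₂ := T))
    have := (Finset.mem_powersetCard.mp hS).2
    omega

theorem card_avoiding_values {n q : ℕ} (S T : Finset (Fin n)) (a : Fin n → Fin q) :
    (cubeFace Sᶜ a \ cubeFace (S ∪ T) a).card =
      q ^ (T.card - (S ∩ T).card) *
        (q ^ (n - T.card - (S.card - (S ∩ T).card)) - 1) := by
  have hinter : cubeFace (S ∪ T) a ∩ cubeFace Sᶜ a = cubeFace (T \ S) a := by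
    ext x
    simp only [Finset.mem_inter, mem_cubeFace, ← forall_and]
    refine forall_congr' fun i => ?_
    simp only [Finset.mem_union, Finset.mem_compl, Finset.mem_sdiff]
    tauto
  rw [Finset.card_sdiff, hinter, card_cubeFace, card_cubeFace, Nat.mul_sub, mul_one, ← pow_add]
  have h1 := Finset.card_inter_add_card_sdiff T S
  have h2 := Finset.card_union_add_card_inter S T
  have h3 := (S ∪ T).card_le_univ
  have h4 := Finset.card_le_card (Finset.inter_subset_left (s₁ := S) (s₂ := T))
  rw [Finset.inter_comm] at h1
  rw [Fintype.card_fin] at h3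
  rw [Finset.card_compl, Fintype.card_fin]
  congr 2 <;> omega

theorem empty_intersection_face_count {n q : ℕ} (hq : 2 ≤ q) (ν k : ℕ)
    (hν : ν ≤ n) (hk : k ≤ n) (A : Finset (Fin n → Fin q)) (hA : IsFace ν A) :
    {F : Finset (Fin n → Fin q) | IsFace k F ∧ A ∩ F = ∅}.ncard =
      ∑ i ∈ Finset.range (ν + 1),
        q ^ (ν - i) * ν.choose i * chooseZ (n - ν) ((k : ℤ) - i) *
          (q ^ (n - ν - (k - i)) - 1) := by
  obtain ⟨T, rfl, a, hA⟩ := hA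
  change A = cubeFace T a at hA
  subst hA
  let P : Finset (Σ _ : Finset (Fin n), Fin n → Fin q) :=
    (Finset.univ.powersetCard k).sigma fun S => cubeFace Sᶜ a \ cubeFace (S ∪ T) a
  have himage : {F : Finset (Fin n → Fin q) | IsFace k F ∧ cubeFace T a ∩ F = ∅} =
      (P.image fun p => cubeFace p.1 p.2 : Finset (Finset (Fin n → Fin q))) := by
    ext F
    simp only [Set.mem_ofPred_eq, Finset.coe_image, Set.mem_image, Finset.mem_coe, P,
      Finset.mem_sigma, Finset.mem_sdiff, Finset.mem_powersetCard, Finset.subset_univ, true_and]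
    constructor
    · rintro ⟨⟨S, hS, c, hF⟩, hempty⟩
      change F = cubeFace S c at hF
      subst hF
      have heq : cubeFace S (fun i => if i ∈ S then a i else c i) = cubeFace S c :=
        (cubeFace_eq_iff hq).mpr ⟨rfl, fun i hi => by simp [hi]⟩
      refine ⟨⟨S, fun i => if i ∈ S then a i else c i⟩, ⟨hS, ?_, ?_⟩, heq⟩
      · rw [mem_cubeFace]
        intro i hi
        simp [Finset.notMem_compl.mp hi]
      · rw [← cubeFace_inter_eq_empty_iff, heq]
        exact hempty
    · rintro ⟨⟨S, c⟩, ⟨hS, -, hc⟩, rfl⟩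
      exact ⟨⟨S, hS, c, rfl⟩, cubeFace_inter_eq_empty_iff.mpr hc⟩
  have hinj : Set.InjOn (fun p : Σ _ : Finset (Fin n), Fin n → Fin q => cubeFace p.1 p.2) P := by
    rintro ⟨S, c⟩ h ⟨S', c'⟩ h' heq
    simp only [P, Finset.mem_coe, Finset.mem_sigma, Finset.mem_sdiff, mem_cubeFace] at h h'
    obtain ⟨rfl, hcc⟩ := (cubeFace_eq_iff hq).mp heq
    have : c = c' := by
      funext i
      by_cases hi : i ∈ S
      · rw [h.2.1 i (by simpa using hi), h'.2.1 i (by simpa using hi)]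
      · exact hcc i hi
    rw [this]
  rw [himage, Set.ncard_coe_finset, Finset.card_image_of_injOn hinj, Finset.card_sigma]
  have hmaps : ∀ S ∈ (Finset.univ : Finset (Fin n)).powersetCard k,
      (S ∩ T).card ∈ Finset.range (T.card + 1) := fun S _ =>
    Finset.mem_range_succ_iff.mpr (Finset.card_le_card Finset.inter_subset_right)
  rw [← Finset.sum_fiberwise_of_maps_to hmaps]
  refine Finset.sum_congr rfl fun i _ => ?_
  rw [Finset.sum_congr rfl (g := fun _ => q ^ (T.card - i) * (q ^ (n - T.card - (k - i)) - 1)),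
    Finset.sum_const, card_filter_card_inter_eq, Fintype.card_fin, smul_eq_mul]
  · ring
  · intro S hS
    simp only [Finset.mem_filter, Finset.mem_powersetCard] at hS
    rw [card_avoiding_values, hS.2, hS.1.2]
end
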